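/- Let a ≥ 21 and let ρ be the largest root of x^3 - a x^2 - (a+3)x - 1. If ε is a totally positive unit of the order ℤ[ρ] with ε ≠ 1, then N(1+ε) > a^2, where N denotes the product over the three real embeddings. -/

import Mathlib

namespace SimplestCubic

/-- The root `r` of the simplest cubic together with its conjugates `-1 - 1/r` and `-1/(1+r)`. -/
noncomputable def root (r : ℝ) : ℝ × ℝ × ℝ := (r, -(r + 1) / r, -1 / (r + 1))

/-- The first cyclic conjugate of `root r`. -/
noncomputable def root' (r : ℝ) : ℝ × ℝ × ℝ := (-(r + 1) / r, -1 / (r + 1), r)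

/-- The second cyclic conjugate of `root r`. -/
noncomputable def root'' (r : ℝ) : ℝ × ℝ × ℝ := (-1 / (r + 1), r, -(r + 1) / r)

/-- The order `ℤ[ρ]`, embedded in `ℝ³` by its three real embeddings. -/
noncomputable def order (r : ℝ) : Subring (ℝ × ℝ × ℝ) := Subring.closure {root r}

/-- The product of the differences of the conjugates. -/
def vandermonde (x : ℝ × ℝ × ℝ) : ℝ := (x.1 - x.2.1) * (x.2.1 - x.2.2) * (x.2.2 - x.1)

/-- The size of a unit, as measured by the squares of its conjugates and their inverses. -/
noncomputable def size (x : ℝ × ℝ × ℝ) : ℝ :=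
  x.1 ^ 2 + x.2.1 ^ 2 + x.2.2 ^ 2 + (x.1 ^ 2)⁻¹ + (x.2.1 ^ 2)⁻¹ + (x.2.2 ^ 2)⁻¹

/-- Elements that agree, up to a square, with a monomial in `-1`, `ρ` and `ρ'`. -/
def IsMonomialModSquares (r : ℝ) (x : ℝ × ℝ × ℝ) : Prop :=
  ∃ k e f : ℕ, ∃ v ∈ order r, x = (-1) ^ k * root r ^ e * root' r ^ f * v ^ 2

variable {r : ℝ} {a : ℤ}

theorem root_mul (hr : 0 < r) : root r * root' r * root'' r = 1 := by
  have : r + 1 ≠ 0 := by positivity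
  ext <;> simp [root, root', root''] <;> field_simp <;> ring

theorem root_add (hr : 0 < r) (h : (a : ℝ) = r - 1 - 1 / r - 1 / (r + 1)) :
    root r + root' r + root'' r = a := by
  have : r + 1 ≠ 0 := by positivity
  ext <;> simp [root, root', root'', h] <;> field_simp <;> ring

theorem root'_eq (hr : 0 < r) (h : (a : ℝ) = r - 1 - 1 / r - 1 / (r + 1)) :
    root' r = a + 2 + a * root r - root r ^ 2 := by
  have : r + 1 ≠ 0 := by positivity
  ext <;> simp [root, root', h] <;> field_simp <;> ring

theorem root_pow_three (hr : 0 < r) (h : (a : ℝ) = r - 1 - 1 / r - 1 / (r + 1)) :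
    root r ^ 3 = a * root r ^ 2 + (a + 3) * root r + 1 := by
  have : r + 1 ≠ 0 := by positivity
  ext <;> simp [root, h] <;> field_simp <;> ring

theorem root_mem : root r ∈ order r := Subring.subset_closure rfl

theorem root'_mem (hr : 0 < r) (h : (a : ℝ) = r - 1 - 1 / r - 1 / (r + 1)) :
    root' r ∈ order r := by
  rw [root'_eq hr h]
  have h2 : (2 : ℝ × ℝ × ℝ) ∈ order r := ofNat_mem _ 2
  exact sub_mem (add_mem (add_mem (intCast_mem _ _) h2)
    (mul_mem (intCast_mem _ _) root_mem)) (pow_mem root_mem 2)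

theorem root''_mem (hr : 0 < r) (h : (a : ℝ) = r - 1 - 1 / r - 1 / (r + 1)) :
    root'' r ∈ order r := by
  have : root'' r = a - root r - root' r := by linear_combination root_add hr h
  rw [this]
  exact sub_mem (sub_mem (intCast_mem _ _) root_mem) (root'_mem hr h)

theorem exists_coordinates (hr : 0 < r) (h : (a : ℝ) = r - 1 - 1 / r - 1 / (r + 1))
    {x : ℝ × ℝ × ℝ} (hx : x ∈ order r) :
    ∃ c₀ c₁ c₂ : ℤ, x = c₀ + c₁ * root r + c₂ * root r ^ 2 := by
  have h3 := root_pow_three hr h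
  induction hx using Subring.closure_induction with
  | mem x hx => exact ⟨0, 1, 0, by simpa using hx⟩
  | zero => exact ⟨0, 0, 0, by simp⟩
  | one => exact ⟨1, 0, 0, by simp⟩
  | add x y _ _ hx hy =>
    obtain ⟨c₀, c₁, c₂, rfl⟩ := hx
    obtain ⟨d₀, d₁, d₂, rfl⟩ := hy
    exact ⟨c₀ + d₀, c₁ + d₁, c₂ + d₂, by push_cast; ring⟩
  | neg x _ hx =>
    obtain ⟨c₀, c₁, c₂, rfl⟩ := hx
    exact ⟨-c₀, -c₁, -c₂, by push_cast; ring⟩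
  | mul x y _ _ hx hy =>
    obtain ⟨c₀, c₁, c₂, rfl⟩ := hx
    obtain ⟨d₀, d₁, d₂, rfl⟩ := hy
    refine ⟨c₀ * d₀ + (c₁ * d₂ + c₂ * d₁) + c₂ * d₂ * a,
      c₀ * d₁ + c₁ * d₀ + (c₁ * d₂ + c₂ * d₁) * (a + 3) + c₂ * d₂ * (a * (a + 3) + 1),
      c₀ * d₂ + c₁ * d₁ + c₂ * d₀ + (c₁ * d₂ + c₂ * d₁) * a + c₂ * d₂ * (a ^ 2 + a + 3), ?_⟩
    push_cast
    linear_combination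
      ((c₁ * d₂ + c₂ * d₁) + c₂ * d₂ * (root r + a) : ℝ × ℝ × ℝ) * h3

theorem norm_eq_intCast (hr : 0 < r) (h : (a : ℝ) = r - 1 - 1 / r - 1 / (r + 1))
    {x : ℝ × ℝ × ℝ} (hx : x ∈ order r) : ∃ n : ℤ, x.1 * x.2.1 * x.2.2 = n := by
  have : r + 1 ≠ 0 := by positivity
  obtain ⟨c₀, c₁, c₂, rfl⟩ := exists_coordinates hr h hx
  refine ⟨c₀ ^ 3 + c₀ ^ 2 * c₁ * a + c₀ ^ 2 * c₂ * (a ^ 2 + 2 * (a + 3)) - c₀ * c₁ ^ 2 * (a + 3)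
    + c₀ * c₁ * c₂ * (-a * (a + 3) - 3) + c₀ * c₂ ^ 2 * ((a + 3) ^ 2 - 2 * a) + c₁ ^ 3
    + c₁ ^ 2 * c₂ * a - c₁ * c₂ ^ 2 * (a + 3) + c₂ ^ 3, ?_⟩
  simp only [root, Prod.fst_add, Prod.snd_add, Prod.fst_mul, Prod.snd_mul, Prod.fst_intCast,
    Prod.snd_intCast, Prod.pow_fst, Prod.pow_snd]
  push_cast
  rw [h]
  field_simp
  ring

theorem sq_norm_eq_one (hr : 0 < r) (h : (a : ℝ) = r - 1 - 1 / r - 1 / (r + 1))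
    {x y : ℝ × ℝ × ℝ} (hx : x ∈ order r) (hy : y ∈ order r) (hxy : x * y = 1) :
    x.1 ^ 2 * x.2.1 ^ 2 * x.2.2 ^ 2 = 1 := by
  obtain ⟨m, hm⟩ := norm_eq_intCast hr h hx
  obtain ⟨n, hn⟩ := norm_eq_intCast hr h hy
  simp only [Prod.ext_iff, Prod.fst_mul, Prod.snd_mul, Prod.fst_one, Prod.snd_one] at hxy
  obtain ⟨h1, h2, h3⟩ := hxy
  have hmn : m * n = 1 := by
    have : (m : ℝ) * n = 1 := by
      rw [← hm, ← hn]
      linear_combination (x.2.1 * y.2.1 * x.2.2 * y.2.2) * h1 + (x.2.2 * y.2.2) * h2 + h3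
    exact_mod_cast this
  have hm2 : m ^ 2 = 1 := by
    rcases Int.eq_one_or_neg_one_of_mul_eq_one hmn with rfl | rfl <;> norm_num
  have hm2' : (m : ℝ) ^ 2 = 1 := by exact_mod_cast hm2
  rw [← hm2', ← hm]
  ring

/-- The simplest cubic form has no nontrivial zero, since it is odd unless both arguments
are even. -/
theorem cubicForm_ne_zero (a t c : ℤ) (hne : t ≠ 0 ∨ c ≠ 0) :
    t ^ 3 - a * t ^ 2 * c - (a + 3) * t * c ^ 2 - c ^ 3 ≠ 0 := by
  intro h0
  have hg : 0 < Int.gcd t c := Int.gcd_pos_iff.2 hne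
  obtain ⟨t', c', hcop, ht, hc⟩ := Int.exists_gcd_one hg
  generalize Int.gcd t c = g at hg ht hc
  have hg' : (g : ℤ) ^ 3 ≠ 0 := by positivity
  have h0' : t' ^ 3 - a * t' ^ 2 * c' - (a + 3) * t' * c' ^ 2 - c' ^ 3 = 0 := by
    apply (mul_eq_zero.1 _).resolve_left hg'
    rw [← h0, ht, hc]
    ring
  have hev := congrArg (Even : ℤ → Prop) h0'
  simp only [Int.even_sub, Int.even_mul, Int.even_pow, Int.even_add, Even.zero] at hev
  have h3 : ¬ Even (3 : ℤ) := by decide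
  have heven : Even t' ∧ Even c' := by tauto
  have hdvd : (2 : ℤ) ∣ Int.gcd t' c' :=
    Int.dvd_coe_gcd heven.1.two_dvd heven.2.two_dvd
  rw [hcop] at hdvd
  norm_num at hdvd

theorem eq_intCast_or_le_sq_vandermonde (hr : 0 < r)
    (h : (a : ℝ) = r - 1 - 1 / r - 1 / (r + 1)) {x : ℝ × ℝ × ℝ} (hx : x ∈ order r) :
    (∃ n : ℤ, x = n) ∨ ((a : ℝ) ^ 2 + 3 * a + 9) ^ 2 ≤ vandermonde x ^ 2 := by
  have hr1 : r + 1 ≠ 0 := by positivity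
  obtain ⟨c₀, c₁, c₂, rfl⟩ := exists_coordinates hr h hx
  by_cases hc : c₁ = 0 ∧ c₂ = 0
  · left
    exact ⟨c₀, by simp [hc.1, hc.2]⟩
  right
  set t : ℤ := c₁ + c₂ * a with ht
  have hI := cubicForm_ne_zero a t c₂ (by
    by_contra! hcon
    obtain ⟨h1, h2⟩ := hcon
    rw [ht, h2] at h1
    exact hc ⟨by simpa using h1, h2⟩)
  set I : ℤ := t ^ 3 - a * t ^ 2 * c₂ - (a + 3) * t * c₂ ^ 2 - c₂ ^ 3 with hI'
  have hone : (1 : ℝ) ≤ (I : ℝ) ^ 2 := by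
    have : 0 < I ^ 2 := by positivity
    exact_mod_cast this
  have key : vandermonde (c₀ + c₁ * root r + c₂ * root r ^ 2) =
      (a ^ 2 + 3 * a + 9) * I := by
    simp only [vandermonde, root, Prod.fst_add, Prod.snd_add, Prod.fst_mul, Prod.snd_mul,
      Prod.fst_intCast, Prod.snd_intCast, Prod.pow_fst, Prod.pow_snd, hI', ht]
    push_cast
    rw [h]
    field_simp
    ring
  rw [key, mul_pow]
  exact le_mul_of_one_le_right (sq_nonneg _) hone

theorem sq_vandermonde_le (x : ℝ × ℝ × ℝ) :
    vandermonde x ^ 2 ≤ ((1 + x.1 ^ 2) * (1 + x.2.1 ^ 2) * (1 + x.2.2 ^ 2)) ^ 2 := by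
  have key (s t : ℝ) : (s - t) ^ 2 ≤ (1 + s ^ 2) * (1 + t ^ 2) := by
    nlinarith [sq_nonneg (1 + s * t)]
  calc vandermonde x ^ 2
      = (x.1 - x.2.1) ^ 2 * (x.2.1 - x.2.2) ^ 2 * (x.2.2 - x.1) ^ 2 := by
        rw [vandermonde]; ring
    _ ≤ ((1 + x.1 ^ 2) * (1 + x.2.1 ^ 2)) * ((1 + x.2.1 ^ 2) * (1 + x.2.2 ^ 2)) *
        ((1 + x.2.2 ^ 2) * (1 + x.1 ^ 2)) := by
        gcongr <;> apply key
    _ = _ := by ring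

namespace IsMonomialModSquares

theorem mul {x y : ℝ × ℝ × ℝ} (hx : IsMonomialModSquares r x) (hy : IsMonomialModSquares r y) :
    IsMonomialModSquares r (x * y) := by
  obtain ⟨k, e, f, v, hv, rfl⟩ := hx
  obtain ⟨k', e', f', v', hv', rfl⟩ := hy
  exact ⟨k + k', e + e', f + f', v * v', mul_mem hv hv', by ring⟩

theorem of_root : IsMonomialModSquares r (root r) := ⟨0, 1, 0, 1, one_mem _, by simp⟩

theorem of_root' : IsMonomialModSquares r (root' r) := ⟨0, 0, 1, 1, one_mem _, by simp⟩

theorem of_root'' (hr : 0 < r) (h : (a : ℝ) = r - 1 - 1 / r - 1 / (r + 1)) :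
    IsMonomialModSquares r (root'' r) :=
  ⟨0, 1, 1, root'' r, root''_mem hr h, by linear_combination (-root'' r) * root_mul hr⟩

/-- A totally positive element that is a monomial modulo squares is a square. -/
theorem exists_sq {x : ℝ × ℝ × ℝ} (hr : 0 < r)
    (h : (a : ℝ) = r - 1 - 1 / r - 1 / (r + 1)) (hx : IsMonomialModSquares r x)
    (h₁ : 0 < x.1) (h₂ : 0 < x.2.1) (h₃ : 0 < x.2.2) : ∃ v ∈ order r, x = v ^ 2 := by
  obtain ⟨k, e, f, v, hv, rfl⟩ := hx
  have hsign : ∀ (n : ℕ) (s : ℝ), 0 ≤ s → 0 < (-1 : ℝ) ^ n * s → Even n := by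
    intro n s hs hpos
    by_contra hodd
    rw [(Nat.not_even_iff_odd.1 hodd).neg_one_pow] at hpos
    linarith
  simp only [root, root', Prod.fst_mul, Prod.snd_mul, Prod.pow_fst, Prod.pow_snd, Prod.fst_neg,
    Prod.snd_neg, Prod.fst_one, Prod.snd_one, neg_div] at h₁ h₂ h₃
  have e₁ : Even (k + f) := hsign _ (r ^ e * ((r + 1) / r) ^ f * v.1 ^ 2) (by positivity) (by
    rw [neg_pow ((r + 1) / r)] at h₁; convert h₁ using 1; ring)
  have e₂ : Even (k + e + f) :=
    hsign _ (((r + 1) / r) ^ e * (1 / (r + 1)) ^ f * v.2.1 ^ 2) (by positivity) (by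
      rw [neg_pow ((r + 1) / r), neg_pow (1 / (r + 1))] at h₂; convert h₂ using 1; ring)
  have e₃ : Even (k + e) := hsign _ ((1 / (r + 1)) ^ e * r ^ f * v.2.2 ^ 2) (by positivity) (by
    rw [neg_pow (1 / (r + 1))] at h₃; convert h₃ using 1; ring)
  have hk : Even k := by grind
  have he : Even e := by grind
  have hf : Even f := by grind
  obtain ⟨e', rfl⟩ := he
  obtain ⟨f', rfl⟩ := hf
  refine ⟨root r ^ e' * root' r ^ f' * v,
    mul_mem (mul_mem (pow_mem root_mem _) (pow_mem (root'_mem hr h) _)) hv, ?_⟩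
  rw [hk.neg_one_pow]
  ring

end IsMonomialModSquares

/-- Multiplying an unbalanced triple by a triple of roughly inverse shape decreases its size. -/
theorem sum_mul_add_inv_add_one_le {R y₁ y₂ y₃ m₁ m₂ m₃ : ℝ} (h₁₂ : y₂ ≤ y₁) (h₂₃ : y₃ ≤ y₂)
    (h₃ : 0 < y₃) (hprod : y₁ * y₂ * y₃ = 1) (hR : 8 * R * y₃ ≤ y₁)
    (hm₁ : m₁ ≤ 1 / 100) (hm₁' : m₁⁻¹ ≤ 11 / 10 * R) (hm₂ : m₂ ≤ 11 / 10)
    (hm₂' : m₂⁻¹ ≤ 11 / 10) (hm₃ : m₃ ≤ 11 / 10 * R) (hm₃' : m₃⁻¹ ≤ 1 / 100) :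
    (y₁ * m₁ + y₂ * m₂ + y₃ * m₃ + (y₁ * m₁)⁻¹ + (y₂ * m₂)⁻¹ + (y₃ * m₃)⁻¹) + 1 ≤
      y₁ + y₂ + y₃ + y₁⁻¹ + y₂⁻¹ + y₃⁻¹ := by
  have h₂ : 0 < y₂ := h₃.trans_le h₂₃
  have h₁ : 0 < y₁ := h₂.trans_le h₁₂
  have hR' : 8 * R * y₁⁻¹ ≤ y₃⁻¹ := by
    rw [← div_eq_mul_inv, div_le_iff₀ h₁, inv_mul_eq_div, le_div_iff₀ h₃]
    exact hR
  have hone : 1 ≤ y₁ := by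
    by_contra! hlt
    have h12 : y₁ * y₂ < 1 := by nlinarith
    nlinarith
  have hone' : 1 ≤ y₃⁻¹ := by
    rw [one_le_inv₀ h₃]
    by_contra! hlt
    have h12 : 1 < y₁ * y₂ := by nlinarith
    nlinarith
  have hinv : y₂⁻¹ ≤ y₃⁻¹ := inv_anti₀ h₃ h₂₃
  have p₁ := inv_pos.2 h₁
  have p₂ := inv_pos.2 h₂
  have p₃ := inv_pos.2 h₃
  simp only [mul_inv]
  have b₁ := mul_le_mul_of_nonneg_left hm₁ h₁.le
  have b₂ := mul_le_mul_of_nonneg_left hm₂ h₂.le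
  have b₃ := mul_le_mul_of_nonneg_left hm₃ h₃.le
  have b₁' := mul_le_mul_of_nonneg_left hm₁' p₁.le
  have b₂' := mul_le_mul_of_nonneg_left hm₂' p₂.le
  have b₃' := mul_le_mul_of_nonneg_left hm₃' p₃.le
  linarith

theorem mul_le_of_le_sq_vandermonde (hr : 22 < r) {u₁ u₂ u₃ : ℝ} (h₁₂ : u₂ ^ 2 ≤ u₁ ^ 2)
    (h₂₃ : u₃ ^ 2 ≤ u₂ ^ 2) (hprod : u₁ ^ 2 * u₂ ^ 2 * u₃ ^ 2 = 1)
    (hV : (r ^ 2 + r + 1) ^ 2 ≤ ((u₁ - u₂) * (u₂ - u₃) * (u₃ - u₁)) ^ 2) :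
    8 * r ^ 2 * u₃ ^ 2 ≤ u₁ ^ 2 := by
  have key (s t : ℝ) (hst : t ^ 2 ≤ s ^ 2) : (s - t) ^ 2 ≤ 4 * s ^ 2 := by
    nlinarith [sq_nonneg (s + t)]
  have hb : ((u₁ - u₂) * (u₂ - u₃) * (u₃ - u₁)) ^ 2 ≤
      (4 * u₁ ^ 2) * (4 * u₂ ^ 2) * (4 * u₁ ^ 2) := by
    rw [mul_pow, mul_pow, ← neg_sub u₁ u₃, neg_sq]
    gcongr
    · exact key _ _ h₁₂
    · exact key _ _ h₂₃
    · exact key _ _ (h₂₃.trans h₁₂)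
  have hr2 : 512 * r ^ 2 ≤ (r ^ 2 + r + 1) ^ 2 := by
    have : 23 * r ≤ r ^ 2 + r + 1 := by nlinarith
    nlinarith
  have := mul_le_mul_of_nonneg_right (hr2.trans (hV.trans hb)) (sq_nonneg u₃)
  have e : (4 * u₁ ^ 2) * (4 * u₂ ^ 2) * (4 * u₁ ^ 2) * u₃ ^ 2 = 64 * u₁ ^ 2 := by
    linear_combination 64 * u₁ ^ 2 * hprod
  linarith

/-- One of the units `ρ^{±1}` and their conjugates decreases the size of a unit with large
discriminant. -/
theorem exists_size_mul_add_one_le (hr : 22 < r) (h : (a : ℝ) = r - 1 - 1 / r - 1 / (r + 1))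
    {u : ℝ × ℝ × ℝ} (hprod : u.1 ^ 2 * u.2.1 ^ 2 * u.2.2 ^ 2 = 1)
    (hV : (r ^ 2 + r + 1) ^ 2 ≤ vandermonde u ^ 2) :
    ∃ g ∈ order r, ∃ g' ∈ order r, g * g' = 1 ∧ IsMonomialModSquares r g' ∧
      size (u * g) + 1 ≤ size u := by
  have hr0 : 0 < r := by linarith
  have m₁ := root_mem (r := r)
  have m₂ := root'_mem hr0 h
  have m₃ := root''_mem hr0 h
  have i₁ := IsMonomialModSquares.of_root (r := r)
  have i₂ := IsMonomialModSquares.of_root' (r := r)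
  have i₃ := IsMonomialModSquares.of_root'' hr0 h
  have hmul := root_mul hr0
  have pos : 0 < u.1 ^ 2 ∧ 0 < u.2.1 ^ 2 ∧ 0 < u.2.2 ^ 2 := by
    have : u.1 ≠ 0 ∧ u.2.1 ≠ 0 ∧ u.2.2 ≠ 0 := by
      refine ⟨?_, ?_, ?_⟩ <;> intro h0 <;> simp [h0] at hprod
    obtain ⟨h1, h2, h3⟩ := this
    exact ⟨by positivity, by positivity, by positivity⟩
  obtain ⟨q₁, q₂, q₃⟩ := pos
  have cA : r ^ 2 ≤ 11 / 10 * r ^ 2 := by nlinarith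
  have cA' : (r ^ 2)⁻¹ ≤ 1 / 100 := by
    rw [inv_le_comm₀ (by positivity) (by norm_num)]
    nlinarith
  have cB : ((r + 1) / r) ^ 2 ≤ 11 / 10 := by
    rw [div_pow, div_le_iff₀ (by positivity)]
    nlinarith
  have cB' : (((r + 1) / r) ^ 2)⁻¹ ≤ 11 / 10 := by
    rw [div_pow, inv_div, div_le_iff₀ (by positivity)]
    nlinarith
  have cC : (1 / (r + 1)) ^ 2 ≤ 1 / 100 := by
    rw [div_pow, one_pow, div_le_div_iff₀ (by positivity) (by norm_num)]
    nlinarith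
  have cC' : ((1 / (r + 1)) ^ 2)⁻¹ ≤ 11 / 10 * r ^ 2 := by
    rw [one_div, inv_pow, inv_inv]
    nlinarith
  have eA : (1 / (r + 1)) ^ 2 * ((r + 1) / r) ^ 2 = (r ^ 2)⁻¹ := by field_simp
  have eB : r ^ 2 * (1 / (r + 1)) ^ 2 = (((r + 1) / r) ^ 2)⁻¹ := by field_simp
  have eC : ((r + 1) / r) ^ 2 * r ^ 2 = ((1 / (r + 1)) ^ 2)⁻¹ := by field_simp
  -- the small, middle and large conjugates of `ρ`, resp. `ρ⁻¹`, are matched with the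
  -- large, middle and small conjugates of `u`
  have stepB := fun (x y z : ℝ) (h₁₂ : y ^ 2 ≤ x ^ 2) (h₂₃ : z ^ 2 ≤ y ^ 2) (hz : 0 < z ^ 2)
      (hp : x ^ 2 * y ^ 2 * z ^ 2 = 1) hV =>
    sum_mul_add_inv_add_one_le h₁₂ h₂₃ hz hp (mul_le_of_le_sq_vandermonde hr h₁₂ h₂₃ hp hV)
      cC cC' cB cB' cA cA'
  have stepA := fun (x y z : ℝ) (h₁₂ : y ^ 2 ≤ x ^ 2) (h₂₃ : z ^ 2 ≤ y ^ 2) (hz : 0 < z ^ 2)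
      (hp : x ^ 2 * y ^ 2 * z ^ 2 = 1) hV =>
    sum_mul_add_inv_add_one_le h₁₂ h₂₃ hz hp (mul_le_of_le_sq_vandermonde hr h₁₂ h₂₃ hp hV)
      cA' (by rwa [inv_inv]) cB' (by rwa [inv_inv]) cC' (by rwa [inv_inv])
  simp only [vandermonde] at hV
  have hsize {g : ℝ × ℝ × ℝ} {n₁ n₂ n₃ : ℝ} (e₁ : g.1 ^ 2 = n₁) (e₂ : g.2.1 ^ 2 = n₂)
      (e₃ : g.2.2 ^ 2 = n₃) : size (u * g) = u.1 ^ 2 * n₁ + u.2.1 ^ 2 * n₂ + u.2.2 ^ 2 * n₃ +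
        (u.1 ^ 2 * n₁)⁻¹ + (u.2.1 ^ 2 * n₂)⁻¹ + (u.2.2 ^ 2 * n₃)⁻¹ := by
    simp only [size, Prod.fst_mul, Prod.snd_mul, mul_pow, e₁, e₂, e₃]
  have sB : (-(r + 1) / r) ^ 2 = ((r + 1) / r) ^ 2 := by rw [neg_div, neg_sq]
  have sC : (-1 / (r + 1)) ^ 2 = (1 / (r + 1)) ^ 2 := by rw [neg_div, neg_sq]
  have tA : (-(r + 1) / r * (-1 / (r + 1))) ^ 2 = (r ^ 2)⁻¹ := by
    rw [mul_pow, sB, sC, mul_comm, eA]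
  have tB : (-1 / (r + 1) * r) ^ 2 = (((r + 1) / r) ^ 2)⁻¹ := by rw [mul_pow, sC, mul_comm, eB]
  have tC : (r * (-(r + 1) / r)) ^ 2 = ((1 / (r + 1)) ^ 2)⁻¹ := by
    rw [mul_pow, sB, mul_comm, eC]
  rcases le_total (u.1 ^ 2) (u.2.1 ^ 2) with h12 | h12 <;>
  rcases le_total (u.2.1 ^ 2) (u.2.2 ^ 2) with h23 | h23
  · refine ⟨root r, m₁, root' r * root'' r, mul_mem m₂ m₃, by rw [← hmul]; ring, i₂.mul i₃, ?_⟩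
    rw [hsize (Eq.refl (r ^ 2)) sB sC, size]
    linarith [stepB u.2.2 u.2.1 u.1 h23 h12 q₁ (by linarith) (hV.trans_eq (by ring))]
  · rcases le_total (u.1 ^ 2) (u.2.2 ^ 2) with h13 | h13
    · refine ⟨root r * root' r, mul_mem m₁ m₂, root'' r, m₃, hmul, i₃, ?_⟩
      rw [hsize tC tA tB, size]
      linarith [stepA u.2.1 u.2.2 u.1 h23 h13 q₁ (by linarith) (hV.trans_eq (by ring))]
    · refine ⟨root' r, m₂, root r * root'' r, mul_mem m₁ m₃, by rw [← hmul]; ring,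
        i₁.mul i₃, ?_⟩
      rw [hsize sB sC (Eq.refl (r ^ 2)), size]
      linarith [stepB u.2.1 u.1 u.2.2 h12 h13 q₃ (by linarith) (hV.trans_eq (by ring))]
  · rcases le_total (u.1 ^ 2) (u.2.2 ^ 2) with h13 | h13
    · refine ⟨root'' r * root r, mul_mem m₃ m₁, root' r, m₂, by rw [← hmul]; ring, i₂, ?_⟩
      rw [hsize tB tC tA, size]
      linarith [stepA u.2.2 u.1 u.2.1 h13 h12 q₂ (by linarith) (hV.trans_eq (by ring))]
    · refine ⟨root'' r, m₃, root r * root' r, mul_mem m₁ m₂, by rw [← hmul]; ring,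
        i₁.mul i₂, ?_⟩
      rw [hsize sC (Eq.refl (r ^ 2)) sB, size]
      linarith [stepB u.1 u.2.2 u.2.1 h13 h23 q₂ (by linarith) (hV.trans_eq (by ring))]
  · refine ⟨root' r * root'' r, mul_mem m₂ m₃, root r, m₁, by rw [← hmul]; ring, i₁, ?_⟩
    rw [hsize tA tB tC, size]
    linarith [stepA u.1 u.2.1 u.2.2 h12 h23 q₃ (by linarith) (hV.trans_eq (by ring))]

theorem quadratic_le_sqrt_discriminant (hr : 0 < r) (h : (a : ℝ) = r - 1 - 1 / r - 1 / (r + 1)) :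
    r ^ 2 + r + 1 ≤ (a : ℝ) ^ 2 + 3 * a + 9 := by
  have e : (a : ℝ) ^ 2 + 3 * a + 9 - (r ^ 2 + r + 1) =
      (r ^ 2 + r + 1) * (2 * (r * (r + 1)) + 1) / (r * (r + 1)) ^ 2 := by
    rw [h]
    field_simp
    ring
  have : 0 ≤ (r ^ 2 + r + 1) * (2 * (r * (r + 1)) + 1) / (r * (r + 1)) ^ 2 := by positivity
  linarith

theorem isMonomialModSquares_of_mul_eq_one (hr : 22 < r)
    (h : (a : ℝ) = r - 1 - 1 / r - 1 / (r + 1)) {u w : ℝ × ℝ × ℝ} (hu : u ∈ order r)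
    (hw : w ∈ order r) (huw : u * w = 1) : IsMonomialModSquares r u := by
  have hr0 : 0 < r := by linarith
  obtain ⟨n, hn⟩ := exists_nat_ge (size u)
  induction n generalizing u w with
  | zero =>
    have hnorm := sq_norm_eq_one hr0 h hu hw huw
    have h0 : 0 ≤ size u := by unfold size; positivity
    have : u.1 ^ 2 = 0 := by
      have : size u = 0 := le_antisymm (by simpa using hn) h0
      unfold size at this
      have p₁ := sq_nonneg u.1
      have p₂ := sq_nonneg u.2.1
      have p₃ := sq_nonneg u.2.2
      linarith [inv_nonneg.2 p₁, inv_nonneg.2 p₂, inv_nonneg.2 p₃]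
    simp [this] at hnorm
  | succ n ih =>
    have hnorm := sq_norm_eq_one hr0 h hu hw huw
    rcases eq_intCast_or_le_sq_vandermonde hr0 h hu with ⟨m, rfl⟩ | hV
    · have hm : (m ^ 2) ^ 3 = 1 := by
        have : ((m : ℝ) ^ 2) ^ 3 = 1 := by
          simp only [Prod.fst_intCast, Prod.snd_intCast] at hnorm
          linear_combination hnorm
        exact_mod_cast this
      have hm2 : m ^ 2 = 1 := (pow_eq_one_iff_of_nonneg (sq_nonneg m) (by norm_num)).1 hm
      rcases sq_eq_one_iff.1 hm2 with rfl | rfl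
      · exact ⟨0, 0, 0, 1, one_mem _, by simp⟩
      · exact ⟨1, 0, 0, 1, one_mem _, by simp⟩
    · have hD := quadratic_le_sqrt_discriminant hr0 h
      obtain ⟨g, hg, g', hg', hgg, hmon, hlt⟩ := exists_size_mul_add_one_le hr h hnorm
        ((pow_le_pow_left₀ (by positivity) hD 2).trans hV)
      have hug : IsMonomialModSquares r (u * g) := by
        refine ih (mul_mem hu hg) (mul_mem hw hg') ?_ ?_
        · linear_combination g * g' * huw + hgg
        · push_cast at hn
          linarith
      have := hug.mul hmon
      rwa [mul_assoc, hgg, mul_one] at this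

/-- A nontrivial totally positive unit `u` of the order satisfies `N(1 + u) > a ^ 2`. -/
theorem sq_lt_norm_one_add (ha : 0 ≤ a) (hr : 22 < r)
    (h : (a : ℝ) = r - 1 - 1 / r - 1 / (r + 1)) {u w : ℝ × ℝ × ℝ} (hu : u ∈ order r)
    (hw : w ∈ order r) (huw : u * w = 1) (h₁ : 0 < u.1) (h₂ : 0 < u.2.1) (h₃ : 0 < u.2.2)
    (hne : u.1 ≠ 1) : (a : ℝ) ^ 2 < (1 + u.1) * (1 + u.2.1) * (1 + u.2.2) := by
  have hr0 : 0 < r := by linarith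
  have hnorm := sq_norm_eq_one hr0 h hu hw huw
  obtain ⟨v, hv, rfl⟩ :=
    (isMonomialModSquares_of_mul_eq_one hr h hu hw huw).exists_sq hr0 h h₁ h₂ h₃
  have ha' : (0 : ℝ) ≤ a := by exact_mod_cast ha
  rcases eq_intCast_or_le_sq_vandermonde hr0 h hv with ⟨m, rfl⟩ | hV
  · simp only [Prod.pow_fst, Prod.pow_snd, Prod.fst_intCast, Prod.snd_intCast] at hnorm hne
    refine absurd ((pow_eq_one_iff_of_nonneg (sq_nonneg _) (by norm_num : 6 ≠ 0)).1 ?_) hne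
    linear_combination hnorm
  · have := abs_le_of_sq_le_sq' (hV.trans (sq_vandermonde_le v)) (by positivity)
    simp only [Prod.pow_fst, Prod.pow_snd]
    linarith [this.2]

/-- The largest root of the simplest cubic determines the other two. -/
theorem roots_eq (ha : 21 ≤ a) {ρ₁ ρ₂ ρ₃ : ℝ}
    (hfact : ∀ x : ℝ, x ^ 3 - a * x ^ 2 - (a + 3) * x - 1 = (x - ρ₁) * (x - ρ₂) * (x - ρ₃))
    (hmax₂ : ρ₂ ≤ ρ₁) (hmax₃ : ρ₃ ≤ ρ₁) :
    22 < ρ₁ ∧ (a : ℝ) = ρ₁ - 1 - 1 / ρ₁ - 1 / (ρ₁ + 1) ∧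
      (ρ₂ = -(ρ₁ + 1) / ρ₁ ∧ ρ₃ = -1 / (ρ₁ + 1) ∨
        ρ₃ = -(ρ₁ + 1) / ρ₁ ∧ ρ₂ = -1 / (ρ₁ + 1)) := by
  have ha' : (21 : ℝ) ≤ a := by exact_mod_cast ha
  have hlt : (a : ℝ) + 1 < ρ₁ := by
    by_contra! hle
    have h1 := hfact (a + 1)
    have h2 : 0 ≤ ((a : ℝ) + 1 - ρ₁) * (a + 1 - ρ₂) * (a + 1 - ρ₃) :=
      mul_nonneg (mul_nonneg (by linarith) (by linarith)) (by linarith)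
    nlinarith
  have hr : 22 < ρ₁ := by linarith
  have hr0 : ρ₁ ≠ 0 := by positivity
  have hr1 : ρ₁ + 1 ≠ 0 := by positivity
  have hroot := hfact ρ₁
  rw [sub_self, zero_mul, zero_mul] at hroot
  have ha2 : (a : ℝ) = ρ₁ - 1 - 1 / ρ₁ - 1 / (ρ₁ + 1) := by
    field_simp
    linear_combination -hroot
  refine ⟨hr, ha2, ?_⟩
  have hsum : ρ₁ + ρ₂ + ρ₃ = a := by
    linear_combination (hfact 1 + hfact (-1) - 2 * hfact 0) / 2
  have hroot2 : (ρ₂ + (ρ₁ + 1) / ρ₁) * (ρ₂ + 1 / (ρ₁ + 1)) = 0 := by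
    have e : ρ₁ * ρ₂ * ρ₃ = 1 := by linear_combination hfact 0
    have e2 : ρ₃ = a - ρ₁ - ρ₂ := by linear_combination hsum
    rw [e2, ha2] at e
    field_simp at e ⊢
    linear_combination -e
  rcases mul_eq_zero.1 hroot2 with h0 | h0
  · have e2 : ρ₂ = -((ρ₁ + 1) / ρ₁) := by linear_combination h0
    refine Or.inl ⟨by rw [e2, neg_div], ?_⟩
    have e3 : ρ₃ = a - ρ₁ - ρ₂ := by linear_combination hsum
    rw [e3, e2, ha2]
    field_simp
    ring
  · have e2 : ρ₂ = -(1 / (ρ₁ + 1)) := by linear_combination h0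
    refine Or.inr ⟨?_, by rw [e2, neg_div]⟩
    have e3 : ρ₃ = a - ρ₁ - ρ₂ := by linear_combination hsum
    rw [e3, e2, ha2]
    field_simp
    ring

theorem coordinates_mem (c₀ c₁ c₂ : ℤ) : c₀ + c₁ * root r + c₂ * root r ^ 2 ∈ order r :=
  add_mem (add_mem (intCast_mem _ _) (mul_mem (intCast_mem _ _) root_mem))
    (mul_mem (intCast_mem _ _) (pow_mem root_mem 2))

end SimplestCubic

/-- For the simplest cubic field with `a ≥ 21`: if `ε` is a totally positive
unit of the order `ℤ[ρ]` (given by integer coordinates `c₀, c₁, c₂` with respect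
to `1, ρ, ρ^2`, with an inverse in `ℤ[ρ]` having coordinates `d₀, d₁, d₂`) and
`ε ≠ 1`, then `N(1 + ε) > a^2`. -/
theorem norm_one_add_unit_gt (a : ℤ) (ha : 21 ≤ a) (ρ₁ ρ₂ ρ₃ : ℝ)
    (hfact : ∀ x : ℝ, x^3 - a*x^2 - (a+3)*x - 1 = (x - ρ₁) * (x - ρ₂) * (x - ρ₃))
    (hmax₂ : ρ₂ ≤ ρ₁) (hmax₃ : ρ₃ ≤ ρ₁)
    (c₀ c₁ c₂ d₀ d₁ d₂ : ℤ)
    (hunit : ∀ x ∈ ({ρ₁, ρ₂, ρ₃} : Set ℝ),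
      ((c₀ : ℝ) + c₁*x + c₂*x^2) * ((d₀ : ℝ) + d₁*x + d₂*x^2) = 1)
    (hpos : ∀ x ∈ ({ρ₁, ρ₂, ρ₃} : Set ℝ), 0 < (c₀ : ℝ) + c₁*x + c₂*x^2)
    (hne : (c₀ : ℝ) + c₁*ρ₁ + c₂*ρ₁^2 ≠ 1) :
    (1 + ((c₀ : ℝ) + c₁*ρ₁ + c₂*ρ₁^2)) * (1 + ((c₀ : ℝ) + c₁*ρ₂ + c₂*ρ₂^2)) *
      (1 + ((c₀ : ℝ) + c₁*ρ₃ + c₂*ρ₃^2)) > (a : ℝ)^2 := by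
  obtain ⟨hr, h, hroots⟩ := SimplestCubic.roots_eq ha hfact hmax₂ hmax₃
  simp only [Set.mem_insert_iff, Set.mem_singleton_iff, forall_eq_or_imp, forall_eq]
    at hunit hpos
  obtain ⟨u₁, u₂, u₃⟩ := hunit
  obtain ⟨p₁, p₂, p₃⟩ := hpos
  have key := SimplestCubic.sq_lt_norm_one_add (by lia) hr h
    (SimplestCubic.coordinates_mem c₀ c₁ c₂) (SimplestCubic.coordinates_mem d₀ d₁ d₂)
  simp only [SimplestCubic.root, Prod.ext_iff, Prod.fst_add, Prod.snd_add, Prod.fst_mul,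
    Prod.snd_mul, Prod.fst_intCast, Prod.snd_intCast, Prod.pow_fst, Prod.pow_snd, Prod.fst_one,
    Prod.snd_one] at key
  rcases hroots with ⟨e₂, e₃⟩ | ⟨e₃, e₂⟩
  · rw [← e₂, ← e₃] at key
    exact key ⟨u₁, u₂, u₃⟩ p₁ p₂ p₃ hne
  · rw [← e₂, ← e₃] at key
    rw [gt_iff_lt, mul_right_comm]
    exact key ⟨u₁, u₃, u₂⟩ p₁ p₃ p₂ hne
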